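/- Let μ be a complex number and n a positive odd integer. Then det_{1≤i,j≤n}( −δ_{i,j} + C(μ+i+j−2, j) ) = (−1)^{(n−1)/2} · 2^{(n+3)(n+1)/4} · (½(μ−1))_{(n+1)/2} · ( ∏_{i=0}^{(n−1)/2} i!(i+1)! / ( (2i)!(2i+2)! ) ) · ∏_{i=1}^{⌊(n+1)/4⌋} ( (½(μ+6i−1))_{(n−4i+1)/2} )² · ( (½(−μ−3n+6i−3))_{(n−4i+3)/2} )². -/

import Mathlib

/-- Generalized binomial coefficient `C(x,k) = x(x-1)⋯(x-k+1)/k!` for complex `x`. -/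
noncomputable def gbinom (x : ℂ) (k : ℕ) : ℂ :=
  (∏ i ∈ Finset.range k, (x - i)) / (k.factorial : ℂ)

/-- Pochhammer symbol `(x)_k = x(x+1)⋯(x+k-1)`. -/
noncomputable def poch (x : ℂ) (k : ℕ) : ℂ :=
  ∏ i ∈ Finset.range k, (x + i)

open Polynomial in
/-- The coefficient of `t ^ i` in `(t - t ^ 2) ^ k`. -/
noncomputable def quadCoeff (k i : ℕ) : ℝ := ((X - X ^ 2 : ℝ[X]) ^ k).coeff i

open Polynomial in
lemma quadCoeff_zero_left (i : ℕ) : quadCoeff 0 i = if i = 0 then 1 else 0 := by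
  simp [quadCoeff, coeff_one]

open Polynomial in
lemma quadCoeff_eq_zero {k i : ℕ} (h : i < k) : quadCoeff k i = 0 := by
  have : (X - X ^ 2 : ℝ[X]) ^ k = X ^ k * (1 - X) ^ k := by rw [← mul_pow]; ring
  rw [quadCoeff, this, coeff_X_pow_mul', if_neg (by omega)]

open Polynomial in
lemma quadCoeff_self (k : ℕ) : quadCoeff k k = 1 := by
  have : (X - X ^ 2 : ℝ[X]) ^ k = X ^ k * (1 - X) ^ k := by rw [← mul_pow]; ring
  rw [quadCoeff, this, coeff_X_pow_mul', if_pos le_rfl]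
  simp [coeff_zero_eq_eval_zero]

open Polynomial in
lemma quadCoeff_two_mul (k : ℕ) : quadCoeff k (2 * k) = (-1) ^ k := by
  have : (X - X ^ 2 : ℝ[X]) ^ k = X ^ k * (1 - X) ^ k := by rw [← mul_pow]; ring
  rw [quadCoeff, this, coeff_X_pow_mul', if_pos (by omega), show 2 * k - k = k by omega]
  have h : (1 - X : ℝ[X]) ^ k = C ((-1) ^ k) * (X - C 1) ^ k := by
    rw [C_pow, ← mul_pow]; congr 1; simp
  have hm := (monic_X_sub_C (1 : ℝ)).pow k
  have hd : ((X - C (1 : ℝ)) ^ k).natDegree = k := by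
    rw [natDegree_pow, natDegree_X_sub_C, mul_one]
  have : ((X - C (1 : ℝ)) ^ k).coeff k = 1 := by
    have := hm.coeff_natDegree
    rwa [hd] at this
  rw [h, coeff_C_mul, this, mul_one]

open Polynomial in
lemma succ_mul_quadCoeff_succ (k i : ℕ) :
    ((i : ℝ) + 2) * quadCoeff (k + 1) (i + 2)
      = (k + 1) * (quadCoeff k (i + 1) - 2 * quadCoeff k i) := by
  have h : derivative ((X - X ^ 2 : ℝ[X]) ^ (k + 1))
      = C ((k : ℝ) + 1) * ((X - X ^ 2) ^ k - C 2 * (X * (X - X ^ 2) ^ k)) := by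
    simp only [derivative_pow_succ, derivative_sub, derivative_X]
    simp [show (C (2 : ℝ)) = 2 from rfl]
    ring
  have := congrArg (fun p => p.coeff (i + 1)) h
  simp only [coeff_derivative, coeff_C_mul, coeff_sub, coeff_X_mul] at this
  simp only [quadCoeff]
  push_cast at this
  linear_combination this

open Polynomial in
lemma quadCoeff_step (k i : ℕ) :
    ((i : ℝ) + 1 - k) * quadCoeff k (i + 1) = (i - 2 * k) * quadCoeff k i := by
  have h : (X - X ^ 2) * derivative ((X - X ^ 2 : ℝ[X]) ^ k)
      = C (k : ℝ) * ((X - X ^ 2) ^ k - C 2 * (X * (X - X ^ 2) ^ k)) := by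
    rcases k with _ | k
    · simp
    simp only [derivative_pow_succ, derivative_sub, derivative_X]
    simp [show (C (2 : ℝ)) = 2 from rfl]
    ring
  have h2 : (X - X ^ 2) * derivative ((X - X ^ 2 : ℝ[X]) ^ k)
      = X * (derivative ((X - X ^ 2 : ℝ[X]) ^ k))
        - X * (X * derivative ((X - X ^ 2 : ℝ[X]) ^ k)) := by ring
  rw [h2] at h
  have := congrArg (fun p => p.coeff (i + 1)) h
  simp only [coeff_C_mul, coeff_sub, coeff_X_mul, coeff_derivative] at this
  simp only [quadCoeff]
  rcases i with _ | i
  · simp at this ⊢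
    linear_combination this
  · simp only [coeff_X_mul, coeff_derivative] at this
    push_cast at this ⊢
    linear_combination this

/-- The quotient of falling factorials `ρ(ρ-1)⋯(ρ-k+1) / (2ρ(2ρ-1)⋯(2ρ-k+1))` after cancelling
the even-indexed factors of the denominator. -/
noncomputable def halfRatio (ρ : ℝ) (k : ℕ) : ℝ :=
  (if Even k then 1 else 1 / 2) *
    ∏ l ∈ Finset.range (k / 2), (ρ - ((k + 1) / 2 : ℕ) - l) / (2 * (2 * ρ - 1 - 2 * l))

lemma halfRatio_succ {ρ : ℝ} (h : ∀ l : ℕ, 2 * ρ - 1 - 2 * l ≠ 0) (k : ℕ) :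
    (2 * ρ - k) * halfRatio ρ (k + 1) = (ρ - k) * halfRatio ρ k := by
  have key (j : ℕ) : (ρ - j) * ∏ l ∈ Finset.range j, (ρ - (j + 1 : ℕ) - l)
      = (∏ l ∈ Finset.range j, (ρ - j - l)) * (ρ - 2 * j) := by
    have h1 := Finset.prod_range_succ (fun l : ℕ => ρ - j - l) j
    have h2 := Finset.prod_range_succ' (fun l : ℕ => ρ - j - l) j
    rw [h1] at h2
    have h3 : ∏ l ∈ Finset.range j, (ρ - (j + 1 : ℕ) - l)
        = ∏ l ∈ Finset.range j, (ρ - j - (l + 1 : ℕ)) :=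
      Finset.prod_congr rfl fun l _ => by push_cast; ring
    rw [h3]
    push_cast at h2 ⊢
    linear_combination -h2
  rcases Nat.even_or_odd' k with ⟨j, rfl | rfl⟩
  · have e1 : (2 * j + 1) / 2 = j := by omega
    have e2 : (2 * j + 1 + 1) / 2 = j + 1 := by omega
    have e3 : (2 * j) / 2 = j := by omega
    have o : ¬ Even (2 * j + 1) := by simp
    simp only [halfRatio, e1, e2, e3, o, even_two_mul, if_true, if_false, Finset.prod_div_distrib]
    have := key j
    push_cast at this ⊢
    linear_combination (1 / ∏ l ∈ Finset.range j, (2 * (2 * ρ - 1 - 2 * (l : ℝ)))) * this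
  · have e1 : (2 * j + 1) / 2 = j := by omega
    have e2 : (2 * j + 1 + 1) / 2 = j + 1 := by omega
    have e3 : (2 * j + 1 + 1 + 1) / 2 = j + 1 := by omega
    have o : ¬ Even (2 * j + 1) := by simp
    have o' : Even (2 * j + 1 + 1) := ⟨j + 1, by ring⟩
    simp only [halfRatio, e1, e2, e3, o, o', if_true, if_false, Finset.prod_div_distrib,
      Finset.prod_range_succ]
    have hj := h j
    have hp : ∏ l ∈ Finset.range j, (2 * (2 * ρ - 1 - 2 * (l : ℝ))) ≠ 0 :=
      Finset.prod_ne_zero_iff.mpr fun l _ => mul_ne_zero two_ne_zero (h l)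
    push_cast
    field_simp
    ring

/-- Coefficients of a terminating `₃F₂` series in `t - t ^ 2`. -/
noncomputable def hypCoeff (m : ℕ) (ρ : ℝ) (k : ℕ) : ℝ :=
  halfRatio ρ k * ∏ i ∈ Finset.range k,
    ((m + 2 * i + 1) * (m + 2 * i + 2 * ρ + 2) / ((i + 1) * (m + i + 2 * ρ + 2)))

lemma hypCoeff_succ {m : ℕ} {ρ : ℝ} (hρ : 0 ≤ ρ) (h : ∀ l : ℕ, 2 * ρ - 1 - 2 * l ≠ 0) (k : ℕ) :
    ((k : ℝ) + 1) * (2 * ρ - k) * (m + k + 2 * ρ + 2) * hypCoeff m ρ (k + 1)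
      = (m + 2 * k + 1) * (m + 2 * k + 2 * ρ + 2) * (ρ - k) * hypCoeff m ρ k := by
  have h1 : (m + k + 2 * ρ + 2 : ℝ) ≠ 0 := by positivity
  have h2 : (k + 1 : ℝ) ≠ 0 := by positivity
  have h3 := halfRatio_succ h k
  simp only [hypCoeff, Finset.prod_range_succ]
  generalize ∏ i ∈ Finset.range k, ((m + 2 * i + 1) * (m + 2 * i + 2 * ρ + 2)
    / ((i + 1) * (m + i + 2 * ρ + 2)) : ℝ) = P
  have h4 : ((k : ℝ) + 1) * (m + k + 2 * ρ + 2) * ((m + 2 * k + 1) * (m + 2 * k + 2 * ρ + 2)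
      / ((k + 1) * (m + k + 2 * ρ + 2))) = (m + 2 * k + 1) * (m + 2 * k + 2 * ρ + 2) :=
    mul_div_cancel₀ _ (mul_ne_zero h2 h1)
  linear_combination (2 * ρ - k) * halfRatio ρ (k + 1) * P * h4
    + P * (m + 2 * k + 1) * (m + 2 * k + 2 * ρ + 2) * h3

/-- Coefficients in powers of `t` of the series with coefficients `hypCoeff` in `t - t ^ 2`. -/
noncomputable def hypSeries (m : ℕ) (ρ : ℝ) (i : ℕ) : ℝ :=
  ∑ k ∈ Finset.range (i + 1), hypCoeff m ρ k * quadCoeff k i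

lemma hypSeries_eq_sum (m : ℕ) (ρ : ℝ) {i K : ℕ} (h : i < K) :
    hypSeries m ρ i = ∑ k ∈ Finset.range K, hypCoeff m ρ k * quadCoeff k i := by
  refine Finset.sum_subset (Finset.range_subset_range.mpr h) fun k _ hk => ?_
  rw [quadCoeff_eq_zero (by simpa using hk), mul_zero]

lemma hypSeries_recurrence {m : ℕ} {ρ : ℝ} (hρ : 0 ≤ ρ) (h : ∀ l : ℕ, 2 * ρ - 1 - 2 * l ≠ 0)
    (i : ℕ) :
    ((i : ℝ) + 2) * (i + 1 - 2 * ρ) * (i + 3 + m + 2 * ρ) * hypSeries m ρ (i + 2)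
      + (2 * i + m + 3) * ((m + 2 * i + 2 * ρ + 4) * (ρ - i - 1) + (i + 1) * (i + 2))
        * hypSeries m ρ (i + 1)
      + (i - 2 * ρ) * (i + m + 1) * (i + m + 2 * ρ + 2) * hypSeries m ρ i = 0 := by
  rw [hypSeries_eq_sum m ρ (show i < i + 3 by omega),
    hypSeries_eq_sum m ρ (show i + 1 < i + 3 by omega), hypSeries]
  simp only [Finset.mul_sum, ← Finset.sum_add_distrib]
  have hterm (k : ℕ) :
      ((i : ℝ) + 2) * (i + 1 - 2 * ρ) * (i + 3 + m + 2 * ρ) * (hypCoeff m ρ k * quadCoeff k (i + 2))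
      + (2 * i + m + 3) * ((m + 2 * i + 2 * ρ + 4) * (ρ - i - 1) + (i + 1) * (i + 2))
        * (hypCoeff m ρ k * quadCoeff k (i + 1))
      + (i - 2 * ρ) * (i + m + 1) * (i + m + 2 * ρ + 2) * (hypCoeff m ρ k * quadCoeff k i)
      = (k - 1 - 2 * ρ) * (k + 1 + m + 2 * ρ) * hypCoeff m ρ k * ((i + 2) * quadCoeff k (i + 2))
      + (m + 2 * k + 1) * (m + 2 * k + 2 * ρ + 2) * (ρ - k) * hypCoeff m ρ k
        * (quadCoeff k (i + 1) - 2 * quadCoeff k i) := by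
    have r1 := quadCoeff_step k i
    have r2 := quadCoeff_step k (i + 1)
    push_cast at r2
    linear_combination hypCoeff m ρ k * (i + 2) * (i + 2 + k + m) * r2
      - hypCoeff m ρ k * (i ^ 2 + (m + 2) * i - 2 * ρ * (m + 2 * ρ + 2)
        + (2 * k + m + 1) * (i + 2 * k + m + 2)) * r1
  rw [Finset.sum_congr rfl fun k _ => hterm k, Finset.sum_add_distrib, Finset.sum_range_succ',
    Finset.sum_range_succ _ (i + 2), quadCoeff_eq_zero (show i < i + 2 by omega),
    quadCoeff_eq_zero (show i + 1 < i + 2 by omega), quadCoeff_zero_left, if_neg (by omega)]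
  simp only [mul_zero, sub_zero, add_zero]
  rw [← Finset.sum_add_distrib]
  refine Finset.sum_eq_zero fun k _ => ?_
  rw [succ_mul_quadCoeff_succ]
  have := hypCoeff_succ (m := m) hρ h k
  push_cast
  linear_combination -(quadCoeff k (i + 1) - 2 * quadCoeff k i) * this

/-- The sequence `C(m + i, i)`. -/
noncomputable def risingBinom (m i : ℕ) : ℝ := ((m + i).choose i : ℝ)

lemma risingBinom_ne_zero (m i : ℕ) : risingBinom m i ≠ 0 := by
  have : 0 < (m + i).choose i := Nat.choose_pos (by omega)
  simp only [risingBinom]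
  positivity

lemma risingBinom_succ (m i : ℕ) :
    ((i : ℝ) + 1) * risingBinom m (i + 1) = (m + i + 1) * risingBinom m i := by
  have := Nat.add_one_mul_choose_eq (m + i) i
  have := congrArg (Nat.cast : ℕ → ℝ) this
  simp only [risingBinom]
  push_cast [← add_assoc] at this ⊢
  linear_combination -this

/-- Leading coefficient of the recurrence satisfied by `selfDualSeq`. -/
noncomputable def recTop (m : ℕ) (ρ s : ℝ) : ℝ := (s - 1 - 2 * ρ) * (s + 1 + m + 2 * ρ) * (s + m)

/-- Middle coefficient of the recurrence satisfied by `selfDualSeq`. -/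
noncomputable def recMid (m : ℕ) (ρ s : ℝ) : ℝ :=
  (2 * s + m - 1) * ((m + 2 * s + 2 * ρ) * (ρ - s + 1) + (s - 1) * s)

/-- Last coefficient of the recurrence satisfied by `selfDualSeq`. -/
noncomputable def recLast (m : ℕ) (ρ s : ℝ) : ℝ := (s - 1) * (s - 2 - 2 * ρ) * (s + m + 2 * ρ)

/-- The recurrence is invariant under the binomial involution. -/
lemma binomial_transform_recurrence {m : ℕ} {ρ : ℝ} {x : ℕ → ℝ}
    (hx : ∀ k : ℕ, recTop m ρ (k + 1) * x (k + 1) + recMid m ρ (k + 1) * x k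
      + recLast m ρ (k + 1) * x (k - 1) = 0) (n : ℕ) :
    recTop m ρ (n + 2) * (∑ k ∈ Finset.range (n + 3), (-1) ^ k * (n + 2).choose k * x k)
      + recMid m ρ (n + 2) * (∑ k ∈ Finset.range (n + 2), (-1) ^ k * (n + 1).choose k * x k)
      + recLast m ρ (n + 2) * (∑ k ∈ Finset.range (n + 1), (-1) ^ k * n.choose k * x k) = 0 := by
  have extend (N K : ℕ) (h : N + 1 ≤ K) :
      ∑ k ∈ Finset.range (N + 1), (-1) ^ k * (N.choose k : ℝ) * x k
        = ∑ k ∈ Finset.range K, (-1) ^ k * (N.choose k : ℝ) * x k := by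
    refine Finset.sum_subset (Finset.range_subset_range.mpr h) fun k _ hk => ?_
    rw [Nat.choose_eq_zero_of_lt (by simpa using hk)]
    simp
  rw [extend (n + 1) (n + 3) (by omega), extend n (n + 3) (by omega)]
  simp only [Finset.mul_sum, ← Finset.sum_add_distrib]
  have h1 (k : ℕ) : ((k : ℝ) + 1) * (n + 1).choose (k + 1) = (n + 1 - k) * (n + 1).choose k := by
    have := Nat.choose_succ_right_eq (n + 1) k
    rcases le_or_gt k (n + 1) with hk | hk
    · have := congrArg (Nat.cast : ℕ → ℝ) this
      push_cast [Nat.cast_sub hk] at this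
      linear_combination this
    · simp [Nat.choose_eq_zero_of_lt hk, Nat.choose_eq_zero_of_lt (show n + 1 < k + 1 by omega)]
  have h2 (k : ℕ) : ((n : ℝ) + 1) * n.choose k = (n + 1 - k) * (n + 1).choose k := by
    have := Nat.add_one_mul_choose_eq n k
    have := congrArg (Nat.cast : ℕ → ℝ) this
    push_cast at this
    rw [this, ← h1]
    ring
  have hterm (k : ℕ) : recTop m ρ (n + 2) * ((-1) ^ k * (n + 2).choose k * x k)
      + recMid m ρ (n + 2) * ((-1) ^ k * (n + 1).choose k * x k)
      + recLast m ρ (n + 2) * ((-1) ^ k * n.choose k * x k)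
      = (if k = 0 then 0 else
          (-1) ^ k * (n + 1).choose (k - 1) * (recTop m ρ k * x k))
        + (-1) ^ (k + 1) * (n + 1).choose k * (recMid m ρ (k + 1) * x k)
        + (-1) ^ k * (n + 1).choose (k + 1) * (recLast m ρ (k + 2) * x k) := by
    rcases k with _ | k
    · have a1 := h1 0
      have a2 := h2 0
      simp [recTop, recMid, recLast] at a1 a2 ⊢
      ring
    · rw [if_neg (by omega), Nat.choose_succ_succ (n + 1) k]
      have a1 := h1 k
      have a2 := h1 (k + 1)
      have a3 := h2 (k + 1)
      simp only [recTop, recMid, recLast, Nat.add_sub_cancel]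
      push_cast at a1 a2 a3 ⊢
      linear_combination (-1) ^ (k + 1) * x (k + 1) *
        ((n - 2 * ρ) * (n + 2 + m + 2 * ρ) * a3 - (k + 1 - 2 * ρ) * (k + 3 + m + 2 * ρ) * a2
        - ((n + 2) ^ 2 + m * (n + 2) - (1 + 2 * ρ) * (1 + m + 2 * ρ)
          + (k + 1 + m) * (n + k + 3 + m)) * a1)
  rw [Finset.sum_congr rfl fun k _ => hterm k, Finset.sum_add_distrib, Finset.sum_add_distrib,
    Finset.sum_range_succ', Finset.sum_range_succ _ (n + 2), Finset.sum_range_succ _ (n + 2)]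
  have hlast : ∑ k ∈ Finset.range (n + 2), (-1) ^ (k + 1) * ((n + 1).choose k : ℝ)
      * (recLast m ρ (k + 1) * x (k - 1))
      = ∑ k ∈ Finset.range (n + 2), (-1) ^ k * ((n + 1).choose (k + 1) : ℝ)
      * (recLast m ρ (k + 2) * x k) := by
    rw [Finset.sum_range_succ', Finset.sum_range_succ _ (n + 1),
      Nat.choose_eq_zero_of_lt (show n + 1 < n + 1 + 1 by omega)]
    have : recLast m ρ 1 = 0 := by simp [recLast]
    simp only [Nat.cast_zero, zero_add, this, zero_mul, mul_zero, add_zero, Nat.add_sub_cancel]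
    refine Finset.sum_congr rfl fun k _ => ?_
    push_cast
    rw [show (k : ℝ) + 1 + 1 = k + 2 by ring]
    ring
  rw [← hlast]
  simp only [Nat.choose_eq_zero_of_lt (show n + 1 < n + 2 by omega),
    Nat.choose_eq_zero_of_lt (show n + 1 < n + 2 + 1 by omega), Nat.cast_zero, mul_zero, zero_mul,
    add_zero, if_true, Nat.add_sub_cancel, Nat.add_eq_zero_iff, one_ne_zero, and_false, if_false]
  simp only [← Finset.sum_add_distrib]
  refine Finset.sum_eq_zero fun k _ => ?_
  have := hx k
  push_cast
  linear_combination (-1) ^ (k + 1) * ((n + 1).choose k : ℝ) * this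

/-- The sequence `hypSeries m ρ i / C(m + i, i)`. -/
noncomputable def selfDualSeq (m : ℕ) (ρ : ℝ) (i : ℕ) : ℝ := hypSeries m ρ i / risingBinom m i

lemma selfDualSeq_zero (m : ℕ) (ρ : ℝ) : selfDualSeq m ρ 0 = 1 := by
  simp [selfDualSeq, hypSeries, risingBinom, hypCoeff, halfRatio, quadCoeff_zero_left]

lemma selfDualSeq_one (m : ℕ) {ρ : ℝ} (hρ : 0 ≤ ρ) : selfDualSeq m ρ 1 = 1 / 2 := by
  have h1 : (m + 2 * ρ + 2 : ℝ) ≠ 0 := by positivity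
  have h2 : (m + 1 : ℝ) ≠ 0 := by positivity
  simp [selfDualSeq, hypSeries, risingBinom, hypCoeff, halfRatio, quadCoeff_zero_left,
    Finset.sum_range_succ, quadCoeff_self]
  field_simp

lemma selfDualSeq_recurrence {m : ℕ} {ρ : ℝ} (hρ : 0 ≤ ρ) (h : ∀ l : ℕ, 2 * ρ - 1 - 2 * l ≠ 0)
    (k : ℕ) :
    recTop m ρ (k + 1) * selfDualSeq m ρ (k + 1) + recMid m ρ (k + 1) * selfDualSeq m ρ k
      + recLast m ρ (k + 1) * selfDualSeq m ρ (k - 1) = 0 := by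
  rcases k with _ | i
  · simp only [zero_add, selfDualSeq_one m hρ, selfDualSeq_zero, recTop, recMid, recLast]
    push_cast
    ring
  have hz := hypSeries_recurrence (m := m) hρ h i
  have hE (j : ℕ) : hypSeries m ρ j = risingBinom m j * selfDualSeq m ρ j := by
    rw [selfDualSeq, mul_div_cancel₀ _ (risingBinom_ne_zero m j)]
  rw [hE, hE, hE] at hz
  have e1 := risingBinom_succ m i
  have e2 := risingBinom_succ m (i + 1)
  refine (mul_eq_zero.mp ?_).resolve_left (risingBinom_ne_zero m (i + 1))
  simp only [recTop, recMid, recLast, Nat.add_sub_cancel]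
  push_cast at e1 e2 ⊢
  linear_combination hz - (i + 1 - 2 * ρ) * (i + 3 + m + 2 * ρ) * selfDualSeq m ρ (i + 2) * e2
    + (i - 2 * ρ) * (i + m + 2 * ρ + 2) * selfDualSeq m ρ i * e1

lemma binomial_transform_selfDualSeq {m : ℕ} {ρ : ℝ} (hρ : 0 ≤ ρ) (h : ∀ i : ℕ, 2 * ρ ≠ i)
    (N : ℕ) :
    ∑ k ∈ Finset.range (N + 1), (-1) ^ k * (N.choose k : ℝ) * selfDualSeq m ρ k
      = selfDualSeq m ρ N := by
  have hodd (l : ℕ) : 2 * ρ - 1 - 2 * l ≠ 0 := fun h0 =>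
    h (2 * l + 1) (by push_cast; linear_combination h0)
  have hx := selfDualSeq_recurrence (m := m) hρ hodd
  induction N using Nat.strong_induction_on with
  | _ N ih =>
    match N with
    | 0 => simp
    | 1 =>
      simp [Finset.sum_range_succ, selfDualSeq_zero, selfDualSeq_one m hρ]
      norm_num
    | n + 2 =>
      have hy := binomial_transform_recurrence hx n
      rw [ih n (by omega), ih (n + 1) (by omega)] at hy
      have hx' := hx (n + 1)
      have htop : recTop m ρ (n + 2) ≠ 0 := by
        have : (n + 2 - 1 - 2 * ρ : ℝ) ≠ 0 := fun h0 =>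
          h (n + 1) (by push_cast; linear_combination -h0)
        have h3 : (n + 2 + 1 + m + 2 * ρ : ℝ) ≠ 0 := by positivity
        have h4 : (n + 2 + m : ℝ) ≠ 0 := by positivity
        exact mul_ne_zero (mul_ne_zero this h3) h4
      refine mul_left_cancel₀ htop ?_
      simp only [Nat.add_sub_cancel] at hx'
      rw [show ((n + 1 : ℕ) : ℝ) + 1 = n + 2 by push_cast; ring] at hx'
      linear_combination hy - hx'

open Filter Topology in
lemma continuousAt_selfDualSeq (m r i : ℕ) :
    ContinuousAt (fun ρ => selfDualSeq m ρ i) (r : ℝ) := by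
  have hodd (l : ℕ) : (2 * (2 * (r : ℝ) - 1 - 2 * l)) ≠ 0 := by
    have : (2 * (2 * (r : ℤ) - 1 - 2 * l)) ≠ 0 := by omega
    exact_mod_cast this
  have hpos (l : ℕ) : ((l : ℝ) + 1) * (m + l + 2 * r + 2) ≠ 0 := by positivity
  have hhalf (k : ℕ) : ContinuousAt (fun ρ => halfRatio ρ k) (r : ℝ) := by
    unfold halfRatio
    refine continuousAt_const.mul (tendsto_finsetProd _ fun l _ => ?_)
    exact ContinuousAt.div (by fun_prop) (by fun_prop) (hodd l)
  have hcoeff (k : ℕ) : ContinuousAt (fun ρ => hypCoeff m ρ k) (r : ℝ) := by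
    unfold hypCoeff
    refine (hhalf k).mul (tendsto_finsetProd _ fun l _ => ?_)
    exact ContinuousAt.div (by fun_prop) (by fun_prop) (hpos l)
  unfold selfDualSeq hypSeries
  exact ContinuousAt.div_const (tendsto_finsetSum _ fun k _ => (hcoeff k).mul_const _) _

open Filter Topology in
lemma binomial_transform_selfDualSeq_nat (m r N : ℕ) :
    ∑ k ∈ Finset.range (N + 1), (-1) ^ k * (N.choose k : ℝ) * selfDualSeq m r k
      = selfDualSeq m r N := by
  have h1 : Tendsto (fun ρ => ∑ k ∈ Finset.range (N + 1), (-1) ^ k * (N.choose k : ℝ)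
      * selfDualSeq m ρ k) (𝓝[>] (r : ℝ))
      (𝓝 (∑ k ∈ Finset.range (N + 1), (-1) ^ k * (N.choose k : ℝ) * selfDualSeq m r k)) :=
    tendsto_finsetSum _ fun k _ =>
      ((continuousAt_selfDualSeq m r k).tendsto.mono_left nhdsWithin_le_nhds).const_mul _
  have h2 : Tendsto (fun ρ => selfDualSeq m ρ N) (𝓝[>] (r : ℝ)) (𝓝 (selfDualSeq m r N)) :=
    (continuousAt_selfDualSeq m r N).tendsto.mono_left nhdsWithin_le_nhds
  refine tendsto_nhds_unique h1 (h2.congr' ?_)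
  filter_upwards [Ioo_mem_nhdsGT (show (r : ℝ) < r + 1 / 2 by linarith)] with ρ hρ
  have hr : (0 : ℝ) ≤ r := Nat.cast_nonneg r
  refine (binomial_transform_selfDualSeq (hr.trans hρ.1.le) (fun i hi => ?_) N).symm
  have a1 : ((2 * r : ℕ) : ℝ) < i := by push_cast; linarith [hρ.1]
  have a2 : (i : ℝ) < ((2 * r + 1 : ℕ) : ℝ) := by push_cast; linarith [hρ.2]
  have b1 := Nat.cast_lt.mp a1
  have b2 := Nat.cast_lt.mp a2
  omega

lemma halfRatio_nat_succ (r k : ℕ) :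
    (2 * r - k) * halfRatio r (k + 1) = (r - k) * halfRatio r k :=
  halfRatio_succ (fun l => by
    have : (2 * (r : ℤ) - 1 - 2 * l) ≠ 0 := by omega
    exact_mod_cast this) k

lemma halfRatio_eq_zero {r k : ℕ} (h1 : r < k) (h2 : k ≤ 2 * r) : halfRatio r k = 0 := by
  induction k, h1 using Nat.le_induction with
  | base =>
    have h := halfRatio_nat_succ r r
    rw [sub_self, zero_mul] at h
    have hr : (2 * r - r : ℝ) ≠ 0 := by
      have : (0 : ℝ) < r := by exact_mod_cast (by omega : 0 < r)
      linarith
    exact (mul_eq_zero.mp h).resolve_left hr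
  | succ k hk ih =>
    have h := halfRatio_nat_succ r k
    rw [ih (by omega), mul_zero] at h
    have hr : (2 * r - k : ℝ) ≠ 0 := by
      have : (k : ℝ) < (2 * r : ℕ) := by exact_mod_cast (by omega : k < 2 * r)
      push_cast at this
      linarith
    exact (mul_eq_zero.mp h).resolve_left hr

lemma halfRatio_self_mul (r : ℕ) :
    halfRatio r r * ((2 * r).factorial : ℝ) = (r.factorial : ℝ) ^ 2 := by
  have key (k : ℕ) (hk : k ≤ r) : halfRatio r k * ((2 * r).descFactorial k : ℝ)
      = (r.descFactorial k : ℝ) := by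
    induction k with
    | zero => simp [halfRatio]
    | succ k ih =>
      have h := halfRatio_nat_succ r k
      have ih := ih (by omega)
      rw [Nat.descFactorial_succ, Nat.descFactorial_succ]
      push_cast [Nat.cast_sub (show k ≤ r by omega), Nat.cast_sub (show k ≤ 2 * r by omega)]
      linear_combination ((2 * r).descFactorial k : ℝ) * h + (r - k) * ih
  have h := key r le_rfl
  have h1 := Nat.factorial_mul_descFactorial (show r ≤ 2 * r by omega)
  rw [show 2 * r - r = r by omega] at h1
  rw [Nat.descFactorial_self] at h
  rw [← h1]
  push_cast
  linear_combination (r.factorial : ℝ) * h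

lemma halfRatio_two_mul_add_one (r : ℕ) :
    2 * halfRatio r (2 * r + 1) = (-1) ^ r * halfRatio r r := by
  have hf : ((2 * r).factorial : ℝ) ≠ 0 := by positivity
  refine mul_right_cancel₀ hf ?_
  rw [mul_assoc ((-1) ^ r), halfRatio_self_mul]
  have e1 : (2 * r + 1) / 2 = r := by omega
  have e2 : (2 * r + 1 + 1) / 2 = r + 1 := by omega
  have o : ¬ Even (2 * r + 1) := by simp
  have key (r : ℕ) : (∏ l ∈ Finset.range r, (2 * (2 * (l : ℝ) + 1))) * (r.factorial : ℝ)
      = ((2 * r).factorial : ℝ) := by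
    induction r with
    | zero => simp
    | succ r ih =>
      rw [Finset.prod_range_succ, show 2 * (r + 1) = 2 * r + 1 + 1 by ring, Nat.factorial_succ,
        Nat.factorial_succ, Nat.factorial_succ]
      push_cast
      rw [← ih]
      ring
  have hden : ∏ l ∈ Finset.range r, (2 * (2 * (r : ℝ) - 1 - 2 * l))
      = ∏ l ∈ Finset.range r, (2 * (2 * (l : ℝ) + 1)) := by
    rw [← Finset.prod_range_reflect]
    refine Finset.prod_congr rfl fun l hl => ?_
    have : l + 1 ≤ r := by simpa using hl
    rw [Nat.sub_sub, Nat.cast_sub (by omega)]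
    push_cast
    ring
  have hnum : ∏ l ∈ Finset.range r, ((r : ℝ) - (r + 1 : ℕ) - l)
      = (-1) ^ r * (r.factorial : ℝ) := by
    rw [← Finset.prod_range_add_one_eq_factorial, ← Finset.card_range r, ← Finset.prod_const,
      Finset.card_range]
    push_cast
    rw [← Finset.prod_mul_distrib]
    exact Finset.prod_congr rfl fun l _ => by ring
  have hne : ∏ l ∈ Finset.range r, (2 * (2 * (l : ℝ) + 1)) ≠ 0 :=
    Finset.prod_ne_zero_iff.mpr fun l _ => by positivity
  rw [halfRatio, e1, e2, if_neg o, Finset.prod_div_distrib, hden, hnum, ← key]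
  field_simp

lemma hypCoeff_eq_zero (m : ℕ) {r k : ℕ} (h1 : r < k) (h2 : k ≤ 2 * r) : hypCoeff m r k = 0 := by
  rw [hypCoeff, halfRatio_eq_zero h1 h2, zero_mul]

/-- The ratio `2 α_{2r+1} / α_r`, up to sign, of the coefficients `α = hypCoeff m r`. -/
noncomputable def coeffRatio (m r : ℕ) : ℝ := ∏ j ∈ Finset.range (r + 1),
  ((m + 2 * r + 2 * j + 1) * (m + 4 * r + 2 * j + 2) / ((r + j + 1) * (m + 3 * r + j + 2)))

lemma two_mul_hypCoeff (m r : ℕ) :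
    2 * hypCoeff m r (2 * r + 1) = (-1) ^ r * hypCoeff m r r * coeffRatio m r := by
  have h := halfRatio_two_mul_add_one r
  rw [hypCoeff, hypCoeff, show 2 * r + 1 = r + (r + 1) by ring, Finset.prod_range_add,
    show r + (r + 1) = 2 * r + 1 by ring, coeffRatio]
  have : ∏ x ∈ Finset.range (r + 1),
      (m + 2 * (r + x : ℕ) + 1) * (m + 2 * (r + x : ℕ) + 2 * (r : ℝ) + 2)
        / (((r + x : ℕ) + 1) * (m + (r + x : ℕ) + 2 * r + 2))
      = ∏ j ∈ Finset.range (r + 1), ((m + 2 * r + 2 * j + 1) * (m + 4 * r + 2 * j + 2)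
        / ((r + j + 1) * (m + 3 * r + j + 2)) : ℝ) := by
    refine Finset.prod_congr rfl fun j _ => ?_
    push_cast
    congr 1 <;> ring
  rw [this]
  linear_combination (∏ i ∈ Finset.range r, ((m + 2 * i + 1) * (m + 2 * i + 2 * r + 2)
    / ((i + 1) * (m + i + 2 * r + 2)) : ℝ)) * (∏ j ∈ Finset.range (r + 1),
    ((m + 2 * r + 2 * j + 1) * (m + 4 * r + 2 * j + 2)
        / ((r + j + 1) * (m + 3 * r + j + 2)) : ℝ)) * h

lemma hypCoeff_self_ne_zero (m r : ℕ) : hypCoeff m r r ≠ 0 := by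
  have h := halfRatio_self_mul r
  have h1 : halfRatio r r ≠ 0 := by
    intro h0
    rw [h0, zero_mul] at h
    have : (r.factorial : ℝ) ^ 2 ≠ 0 := by positivity
    exact this h.symm
  refine mul_ne_zero h1 (Finset.prod_ne_zero_iff.mpr fun i _ => ?_)
  positivity

open Polynomial in
lemma quadCoeff_eq_zero_of_two_mul_lt {k i : ℕ} (h : 2 * k < i) : quadCoeff k i = 0 := by
  refine coeff_eq_zero_of_natDegree_lt (lt_of_le_of_lt (natDegree_pow_le_of_le k ?_) (by
    rwa [mul_comm] : k * 2 < i))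
  compute_degree

open Polynomial in
/-- The polynomial `(t - t ^ 2) ^ k` takes the same values at `1 + t` and `-t`. -/
lemma sum_quadCoeff_mul_choose {k K : ℕ} (h : 2 * k < K) (i : ℕ) :
    ∑ j ∈ Finset.range K, quadCoeff k j * (j.choose i : ℝ) = (-1) ^ i * quadCoeff k i := by
  set p : ℝ[X] := (X - X ^ 2) ^ k with hp
  have hdeg : p.natDegree < K := by
    refine lt_of_le_of_lt (natDegree_pow_le_of_le k ?_) (by rwa [mul_comm] : k * 2 < K)
    compute_degree
  have h1 : p.comp (1 + X) = p.comp (-X) := by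
    simp only [hp, pow_comp, sub_comp, X_comp]
    congr 1
    ring
  have h2 : (p.comp (1 + X)).coeff i = ∑ j ∈ Finset.range K, quadCoeff k j * (j.choose i : ℝ) := by
    rw [comp, eval₂_eq_sum_range' C hdeg, finsetSum_coeff]
    simp [coeff_C_mul, coeff_one_add_X_pow, quadCoeff, hp]
  rw [← h2, h1, show (-X : ℝ[X]) = C (-1) * X by simp, comp_C_mul_X_coeff, mul_comm]
  rfl

lemma hypSeries_eq_sum_range (m : ℕ) {r i : ℕ} (h : i ≤ 2 * r) :
    hypSeries m r i = ∑ k ∈ Finset.range (r + 1), hypCoeff m r k * quadCoeff k i := by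
  rw [hypSeries_eq_sum m r (show i < 2 * r + 1 by omega)]
  refine (Finset.sum_subset (Finset.range_subset_range.mpr (by omega)) fun k hk hk' => ?_).symm
  simp only [Finset.mem_range] at hk hk'
  rw [hypCoeff_eq_zero m (by omega) (by omega), zero_mul]

lemma hypSeries_two_mul (m r : ℕ) : hypSeries m r (2 * r) = (-1) ^ r * hypCoeff m r r := by
  rw [hypSeries_eq_sum_range m le_rfl, Finset.sum_range_succ, quadCoeff_two_mul,
    Finset.sum_eq_zero, zero_add, mul_comm]
  intro k hk
  rw [quadCoeff_eq_zero_of_two_mul_lt (by simp at hk; omega), mul_zero]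

lemma hypSeries_two_mul_add_one (m r : ℕ) :
    hypSeries m r (2 * r + 1) = hypCoeff m r (2 * r + 1) := by
  rw [hypSeries, Finset.sum_range_succ, quadCoeff_self, Finset.sum_eq_zero, zero_add, mul_one]
  intro k hk
  rcases le_or_gt k r with h | h
  · rw [quadCoeff_eq_zero_of_two_mul_lt (by omega), mul_zero]
  · rw [hypCoeff_eq_zero m h (by simp at hk; omega), zero_mul]

lemma sum_hypSeries_mul_choose (m r i : ℕ) :
    ∑ j ∈ Finset.range (2 * r + 1), hypSeries m r j * (j.choose i : ℝ)
      = if i ≤ 2 * r then (-1) ^ i * hypSeries m r i else 0 := by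
  have h1 : ∑ j ∈ Finset.range (2 * r + 1), hypSeries m r j * (j.choose i : ℝ)
      = ∑ k ∈ Finset.range (r + 1), hypCoeff m r k * ((-1) ^ i * quadCoeff k i) := by
    have (j : ℕ) (hj : j ∈ Finset.range (2 * r + 1)) : hypSeries m r j * (j.choose i : ℝ)
        = ∑ k ∈ Finset.range (r + 1), hypCoeff m r k * (quadCoeff k j * (j.choose i : ℝ)) := by
      rw [hypSeries_eq_sum_range m (by simp at hj; omega), Finset.sum_mul]
      exact Finset.sum_congr rfl fun k _ => by ring
    rw [Finset.sum_congr rfl this, Finset.sum_comm]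
    refine Finset.sum_congr rfl fun k hk => ?_
    rw [← Finset.mul_sum, sum_quadCoeff_mul_choose (by simp at hk; omega)]
  rw [h1]
  split_ifs with hi
  · rw [hypSeries_eq_sum_range m hi, Finset.mul_sum]
    exact Finset.sum_congr rfl fun k _ => by ring
  · refine Finset.sum_eq_zero fun k hk => ?_
    rw [quadCoeff_eq_zero_of_two_mul_lt (by simp at hk; omega)]
    ring

/-- Skew-symmetric bordering: if `v` spans the kernel of the leading minor of odd order `N + 1`,
consecutive minors of even order differ by a square. -/
lemma sq_mul_det_of_skew {R : Type*} [CommRing R] {A : ℕ → ℕ → R} (hA : ∀ i j, A j i = -A i j)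
    {N : ℕ} {v : ℕ → R} (hv : ∀ i ≤ N, ∑ j ∈ Finset.range (N + 1), A i j * v j = 0) :
    v N ^ 2 * (Matrix.of fun i j : Fin (N + 2) => A i j).det
      = (∑ j ∈ Finset.range (N + 1), A (N + 1) j * v j) ^ 2
        * (Matrix.of fun i j : Fin N => A i j).det := by
  set h := ∑ j ∈ Finset.range (N + 1), A (N + 1) j * v j with hh
  set M := Matrix.of fun i j : Fin (N + 2) => A i j with hM
  set M' := M.submatrix (Fin.last (N + 1)).succAbove (Fin.last N).castSucc.succAbove with hM'
  have col : v N * M.det = -h * M'.det := by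
    have h1 := Matrix.det_updateCol_sum M (Fin.last N).castSucc
      (fun j => if (j : ℕ) ≤ N then v j else 0)
    have hcol (i : Fin (N + 2)) :
        ∑ j : Fin (N + 2), (if (j : ℕ) ≤ N then v j else 0) • M i j
          = if i = Fin.last (N + 1) then h else 0 := by
      have : ∑ j : Fin (N + 2), (if (j : ℕ) ≤ N then v j else 0) • M i j
          = ∑ j ∈ Finset.range (N + 1), A i j * v j := by
        rw [Fin.sum_univ_castSucc, Finset.sum_range]
        simp [hM, Nat.lt_succ_iff.mp (Fin.is_lt _), mul_comm]
      rw [this]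
      split_ifs with hi
      · rw [hi]; rfl
      · exact hv i (by
          have := i.2
          have : (i : ℕ) ≠ N + 1 := fun h => hi (Fin.ext h)
          omega)
    simp only [hcol] at h1
    rw [Matrix.det_succ_column _ (Fin.last N).castSucc,
      Finset.sum_eq_single (Fin.last (N + 1)) (by simp +contextual) (by simp)] at h1
    simp only [Matrix.updateCol_self, if_true, Matrix.submatrix_updateCol_succAbove] at h1
    simp at h1
    rw [← h1, hM', Fin.succAbove_last]
    ring
  have row : v N * M'.det = -h * (Matrix.of fun i j : Fin N => A i j).det := by
    have h1 := Matrix.det_updateRow_sum M' (Fin.last N) (fun j => v j)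
    have hcol (j : Fin (N + 1)) : ∑ i : Fin (N + 1), v i • M' i j
          = if j = Fin.last N then -h else 0 := by
      have hs (k : ℕ) : ∑ i : Fin (N + 1), v i * A i k
          = -∑ j ∈ Finset.range (N + 1), A k j * v j := by
        rw [Finset.sum_range, ← Finset.sum_neg_distrib]
        exact Finset.sum_congr rfl fun i _ => by rw [hA]; ring
      induction j using Fin.lastCases with
      | last =>
        rw [if_pos rfl, hh, ← hs]
        simp [hM', hM]
      | cast j =>
        rw [if_neg (Fin.castSucc_lt_last j).ne, ← neg_zero, ← hv j (by omega), ← hs]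
        simp [hM', hM, Fin.succAbove_castSucc_of_lt]
    have hsum : ∑ i : Fin (N + 1), v i • M' i = fun j => if j = Fin.last N then -h else 0 := by
      funext j
      rw [← hcol, Finset.sum_apply]
      rfl
    have hminor : M'.submatrix Fin.castSucc Fin.castSucc = Matrix.of fun i j : Fin N => A i j := by
      ext i j
      simp [hM', hM, Fin.succAbove_castSucc_of_lt]
    rw [hsum, Matrix.det_succ_row _ (Fin.last N),
      Finset.sum_eq_single (Fin.last N) (by simp +contextual) (by simp),
      Matrix.submatrix_updateRow_succAbove] at h1
    simp [hminor] at h1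
    rw [← h1]
    ring
  linear_combination v N * col - h * row

/-- Entries of a skew-symmetric matrix whose even minors are, up to a simple factor, the
determinants of the matrices with entries `-δ + C(m + i + j, j)`. -/
noncomputable def skewEntry (m i j : ℕ) : ℝ :=
  (-1) ^ j * risingBinom m j * (j.choose i : ℝ) - (-1) ^ i * risingBinom m i * (i.choose j : ℝ)

lemma sum_skewEntry_mul (m r i : ℕ) (hi : i ≤ 2 * r + 1) :
    ∑ j ∈ Finset.range (2 * r + 1), skewEntry m i j * ((-1) ^ j * selfDualSeq m r j)
      = if i ≤ 2 * r then 0 else 2 * hypSeries m r (2 * r + 1) := by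
  have hz (j : ℕ) : risingBinom m j * selfDualSeq m r j = hypSeries m r j := by
    rw [selfDualSeq, mul_div_cancel₀ _ (risingBinom_ne_zero m j)]
  have hterm (j : ℕ) : skewEntry m i j * ((-1) ^ j * selfDualSeq m r j)
      = hypSeries m r j * (j.choose i : ℝ)
        - (-1) ^ i * risingBinom m i * ((-1) ^ j * (i.choose j : ℝ) * selfDualSeq m r j) := by
    have : ((-1 : ℝ) ^ j) * (-1) ^ j = 1 := by rw [← mul_pow]; simp
    rw [skewEntry, ← hz]
    linear_combination risingBinom m j * (j.choose i : ℝ) * selfDualSeq m r j * this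
  simp only [hterm, Finset.sum_sub_distrib, ← Finset.mul_sum, sum_hypSeries_mul_choose]
  have hs := binomial_transform_selfDualSeq_nat m r i
  split_ifs with h
  · have : ∑ j ∈ Finset.range (2 * r + 1), (-1) ^ j * (i.choose j : ℝ) * selfDualSeq m r j
        = selfDualSeq m r i := by
      rw [← hs]
      refine (Finset.sum_subset (Finset.range_subset_range.mpr (by omega)) fun k _ hk => ?_).symm
      rw [Nat.choose_eq_zero_of_lt (by simpa using hk)]
      simp
    rw [this, mul_assoc, hz, sub_self]
  · obtain rfl : i = 2 * r + 1 := by omega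
    rw [Finset.sum_range_succ, Nat.choose_self, pow_succ, pow_mul] at hs
    rw [← hz, pow_succ, pow_mul]
    norm_num at hs ⊢
    linear_combination risingBinom m (2 * r + 1) * hs

lemma det_skewEntry_add_two (m r : ℕ) :
    (Matrix.of fun i j : Fin (2 * r + 2) => skewEntry m i j).det
      = (coeffRatio m r * risingBinom m (2 * r)) ^ 2
        * (Matrix.of fun i j : Fin (2 * r) => skewEntry m i j).det := by
  have h := sq_mul_det_of_skew (A := skewEntry m) (N := 2 * r)
    (v := fun j => (-1) ^ j * selfDualSeq m r j) (fun i j => by simp only [skewEntry]; ring)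
    (fun i hi => by rw [sum_skewEntry_mul m r i (by omega), if_pos hi])
  rw [sum_skewEntry_mul m r _ le_rfl, if_neg (by omega), hypSeries_two_mul_add_one,
    two_mul_hypCoeff, selfDualSeq, hypSeries_two_mul] at h
  have hE := risingBinom_ne_zero m (2 * r)
  have hα := hypCoeff_self_ne_zero m r
  have hs : ((-1 : ℝ) ^ r) ^ 2 = 1 := by rw [← pow_mul, mul_comm, pow_mul]; simp
  have hs' : ((-1 : ℝ) ^ (2 * r)) = 1 := by rw [pow_mul]; simp
  rw [hs'] at h
  refine mul_left_cancel₀ (pow_ne_zero 2 (div_ne_zero hα hE)) ?_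
  rw [one_mul, div_pow, mul_pow, hs] at h
  field_simp at h ⊢
  rw [hs] at h
  linear_combination h

lemma Matrix.det_eq_zero_of_transpose_eq_neg {n : ℕ} (hn : Odd n) {A : Matrix (Fin n) (Fin n) ℝ}
    (hA : A.transpose = -A) : A.det = 0 := by
  have h := A.det_transpose
  rw [hA, Matrix.det_neg, Fintype.card_fin, hn.neg_one_pow] at h
  linarith

open Polynomial in
lemma sum_choose_mul_choose_mul_neg_one_pow {i K : ℕ} (hi : i < K) (j : ℕ) :
    ∑ k ∈ Finset.range K, (i.choose k : ℝ) * (k.choose j) * (-1) ^ k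
      = if i = j then (-1) ^ j else 0 := by
  have h1 : ∑ k ∈ Finset.range K, (i.choose k : ℝ) * (k.choose j) * (-1) ^ k
      = ∑ k ∈ Finset.range (i + 1), (i.choose k : ℝ) * (k.choose j) * (-1) ^ k := by
    refine (Finset.sum_subset (Finset.range_subset_range.mpr hi) fun k _ hk => ?_).symm
    rw [Nat.choose_eq_zero_of_lt (by simpa using hk)]
    simp
  have h2 := congrArg (fun p : ℝ[X] => p.coeff j) (add_pow (C (-1) * (1 + X) : ℝ[X]) 1 i)
  have h3 (k : ℕ) : ((C (-1) * (1 + X) : ℝ[X]) ^ k * 1 ^ (i - k) * (i.choose k : ℝ[X])).coeff j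
      = (i.choose k : ℝ) * (k.choose j) * (-1) ^ k := by
    rw [mul_pow, ← C_pow, one_pow, mul_one, mul_comm, ← C_eq_natCast, coeff_C_mul, coeff_C_mul,
      coeff_one_add_X_pow]
    ring
  have h4 : (C (-1) * (1 + X) + 1 : ℝ[X]) = C (-1) * X := by simp
  simp only [finsetSum_coeff, h3] at h2
  rw [h4, mul_pow, ← C_pow, coeff_C_mul, coeff_X_pow] at h2
  rw [h1, ← h2]
  rcases eq_or_ne i j with rfl | h
  · simp
  · rw [if_neg h, if_neg h.symm, mul_zero]

/-- A form of the Vandermonde convolution. -/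
lemma sum_choose_mul_choose_div_risingBinom (m : ℕ) {i K : ℕ} (hi : i < K) (j : ℕ) :
    ∑ k ∈ Finset.range K, (i.choose k : ℝ) * (j.choose k) * risingBinom m j / risingBinom m k
      = ((m + i + j).choose j : ℝ) := by
  have hterm (k : ℕ) (hk : k ≤ j) :
      (i.choose k : ℝ) * (j.choose k) * risingBinom m j / risingBinom m k
        = ((i.choose k * (m + j).choose (j - k) : ℕ) : ℝ) := by
    have h := Nat.choose_mul (n := m + j) (show m ≤ m + k by omega)
    rw [Nat.add_sub_cancel_left, Nat.add_sub_cancel_left,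
      Nat.choose_symm_of_eq_add (show m + j = (m + k) + (j - k) by omega),
      Nat.choose_symm_add, Nat.choose_symm_add] at h
    have h := congrArg (Nat.cast : ℕ → ℝ) h
    push_cast at h ⊢
    rw [div_eq_iff (risingBinom_ne_zero m k), risingBinom, risingBinom]
    linear_combination -(i.choose k : ℝ) * h
  have hzero (k : ℕ) (hk : i < k ∨ j < k) :
      (i.choose k : ℝ) * (j.choose k) * risingBinom m j / risingBinom m k = 0 := by
    rcases hk with hk | hk <;> simp [Nat.choose_eq_zero_of_lt hk]
  rw [show m + i + j = i + (m + j) by ring, Nat.add_choose_eq,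
    Finset.Nat.sum_antidiagonal_eq_sum_range_succ_mk, Nat.cast_sum,
    ← Finset.sum_congr rfl fun k hk => hterm k (Nat.lt_succ_iff.mp (Finset.mem_range.mp hk))]
  have e1 := Finset.sum_subset (Finset.range_subset_range.mpr (le_max_left K (j + 1)))
    fun k _ hk => hzero k (Or.inl (hi.trans_le (by simpa using hk)))
  have e2 := Finset.sum_subset (Finset.range_subset_range.mpr (le_max_right K (j + 1)))
    fun k _ hk => hzero k (Or.inr (by simpa using hk))
  rw [e1, e2]

lemma det_xin_eq_det_skewEntry (m : ℕ) {n : ℕ} (hn : Odd n) :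
    (Matrix.of fun i j : Fin n => (if i = j then (-1 : ℝ) else 0)
        + ((m + (i + 1) + (j + 1)).choose (j + 1) : ℝ)).det
      * ∏ j ∈ Finset.range (n + 1), risingBinom m j
      = -(∏ j ∈ Finset.range (n + 1), (-1) ^ j)
        * (Matrix.of fun i j : Fin (n + 1) => skewEntry m i j).det := by
  set W : Matrix (Fin (n + 1)) (Fin (n + 1)) ℝ := Matrix.of fun i j =>
    if j = 0 then (if i = 0 then 1 else 0)
      else (if i = j then (-1) else 0) + ((m + i + j).choose j : ℝ) with hW
  set A := (Matrix.of fun i j : Fin (n + 1) => skewEntry m i j) with hA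
  have hdetW : W.det = (Matrix.of fun i j : Fin n => (if i = j then (-1 : ℝ) else 0)
        + ((m + (i + 1) + (j + 1)).choose (j + 1) : ℝ)).det := by
    rw [Matrix.det_succ_column_zero, Finset.sum_eq_single 0 (by simp +contextual [hW]) (by simp)]
    simp only [hW, Matrix.of_apply, if_true, Fin.val_zero, pow_zero, one_mul]
    congr 1
    ext i j
    simp [Fin.succ_ne_zero]
  have hfac : (Matrix.of fun i k : Fin (n + 1) => ((i : ℕ).choose k : ℝ))
      * (Matrix.of fun k j : Fin (n + 1) => (risingBinom m k)⁻¹ *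
        ((Matrix.of fun k j : Fin (n + 1) => (-1) ^ (j : ℕ) *
          (A.updateCol 0 fun i => (-1) ^ (i : ℕ) * risingBinom m i) k j) k j)) = W := by
    ext i j
    simp only [Matrix.mul_apply, Matrix.of_apply, hW]
    rcases eq_or_ne j 0 with rfl | hj
    · have := sum_choose_mul_choose_mul_neg_one_pow i.2 0
      rw [Finset.sum_range] at this
      simp only [if_true, Matrix.updateCol_self]
      convert this using 2 with k
      · have := risingBinom_ne_zero m k
        rw [Nat.choose_zero_right]
        simp only [Fin.val_zero, pow_zero, Nat.cast_one]
        field_simp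
      · exact Fin.ext_iff
      · simp
    · have h1 := sum_choose_mul_choose_mul_neg_one_pow i.2 j
      have h2 := sum_choose_mul_choose_div_risingBinom m i.2 j
      rw [Finset.sum_range] at h1 h2
      have hs : ((-1 : ℝ) ^ (j : ℕ)) * (-1) ^ (j : ℕ) = 1 := by rw [← mul_pow]; simp
      have h3 : (if i = j then (-1 : ℝ) else 0)
          = -((-1) ^ (j : ℕ) * if (i : ℕ) = j then (-1) ^ (j : ℕ) else 0) := by
        simp only [Fin.ext_iff]
        split_ifs
        · rw [hs]
        · simp
      rw [if_neg hj, ← h2, h3, ← h1, Finset.mul_sum, ← Finset.sum_neg_distrib,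
        ← Finset.sum_add_distrib]
      refine Finset.sum_congr rfl fun k _ => ?_
      have := risingBinom_ne_zero m k
      simp only [Matrix.updateCol_ne hj, hA, Matrix.of_apply, skewEntry]
      field_simp
      linear_combination (i : ℕ).choose k * risingBinom m j * (j : ℕ).choose k * hs
  have hL : (Matrix.of fun i k : Fin (n + 1) => ((i : ℕ).choose k : ℝ)).det = 1 := by
    rw [Matrix.det_of_isLowerTriangular]
    · simp
    · intro i j hij
      have : (i : ℕ) < j := hij
      simp [Nat.choose_eq_zero_of_lt this]
  have hcol : A.det = -(A.updateCol 0 fun i => (-1) ^ (i : ℕ) * risingBinom m i).det := by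
    have h0 : (A.updateCol 0 fun i => if i = 0 then (1 : ℝ) else 0).det = 0 := by
      rw [Matrix.det_succ_column_zero, Finset.sum_eq_single 0 (by simp +contextual) (by simp)]
      have := Matrix.det_eq_zero_of_transpose_eq_neg hn (A := A.submatrix Fin.succ Fin.succ) (by
        ext i j
        simp only [hA, Matrix.transpose_apply, Matrix.submatrix_apply, Matrix.of_apply,
          Matrix.neg_apply, skewEntry]
        ring)
      have hsub : (A.updateCol 0 fun i => if i = 0 then (1 : ℝ) else 0).submatrix
          (Fin.succAbove 0) Fin.succ = A.submatrix Fin.succ Fin.succ := by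
        ext i j
        simp
      rw [hsub, this, mul_zero]
    have h1 := Matrix.det_updateCol_add A 0 (fun i => A i 0)
      (fun i => (-1) ^ (i : ℕ) * risingBinom m i)
    have h2 : ((fun i => A i 0) + fun i : Fin (n + 1) => (-1) ^ (i : ℕ) * risingBinom m i)
        = fun i => if i = 0 then (1 : ℝ) else 0 := by
      funext i
      simp only [Pi.add_apply, hA, Matrix.of_apply, skewEntry, Fin.val_zero]
      rcases eq_or_ne i 0 with rfl | hi
      · simp [risingBinom]
      · have : 0 < (i : ℕ) := Fin.pos_iff_ne_zero.mpr hi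
        simp [Nat.choose_eq_zero_of_lt this, hi]
    rw [h2, h0, Matrix.updateCol_eq_self] at h1
    linarith
  have hdet := congrArg Matrix.det hfac
  rw [Matrix.det_mul, hL, Matrix.det_mul_column, Matrix.det_mul_row, hdetW] at hdet
  rw [← hdet, hcol, Finset.prod_inv_distrib, Finset.prod_range, Finset.prod_range]
  have : ∏ i : Fin (n + 1), risingBinom m i ≠ 0 :=
    Finset.prod_ne_zero_iff.mpr fun i _ => risingBinom_ne_zero m i
  field_simp

lemma det_xin_eq_prod (m r : ℕ) :
    (Matrix.of fun i j : Fin (2 * r + 1) => (if i = j then (-1 : ℝ) else 0)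
        + ((m + (i + 1) + (j + 1)).choose (j + 1) : ℝ)).det
      = (-1) ^ r * ∏ s ∈ Finset.range (r + 1), coeffRatio m s ^ 2 * (2 * s + 1) / (m + 2 * s + 1) := by
  have h := det_xin_eq_det_skewEntry m (n := 2 * r + 1) ⟨r, rfl⟩
  have hsign (r : ℕ) : ∏ j ∈ Finset.range (2 * r + 2), (-1 : ℝ) ^ j = (-1) ^ (r + 1) := by
    induction r with
    | zero => simp [Finset.prod_range_succ]
    | succ r ih =>
      rw [show 2 * (r + 1) + 2 = 2 * r + 2 + 1 + 1 by ring, Finset.prod_range_succ,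
        Finset.prod_range_succ, ih]
      have : (-1 : ℝ) ^ (2 * r) = 1 := by rw [pow_mul]; simp
      simp only [pow_succ, this]
      ring
  have hdet (r : ℕ) : (Matrix.of fun i j : Fin (2 * r) => skewEntry m i j).det
      = (∏ s ∈ Finset.range r, coeffRatio m s ^ 2 * (2 * s + 1) / (m + 2 * s + 1))
        * ∏ j ∈ Finset.range (2 * r), risingBinom m j := by
    induction r with
    | zero => simp
    | succ r ih =>
      have hd := det_skewEntry_add_two m r
      rw [show 2 * (r + 1) = 2 * r + 2 by ring, hd, ih, Finset.prod_range_succ,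
        Finset.prod_range_succ _ (2 * r + 1), Finset.prod_range_succ _ (2 * r)]
      have hE := risingBinom_succ m (2 * r)
      have : (m + 2 * r + 1 : ℝ) ≠ 0 := by positivity
      push_cast at hE
      field_simp
      linear_combination -(coeffRatio m r ^ 2 * risingBinom m (2 * r)
        * (∏ s ∈ Finset.range r, coeffRatio m s ^ 2 * (2 * s + 1) / (m + 2 * s + 1))
        * ∏ j ∈ Finset.range (2 * r), risingBinom m j) * hE
  rw [hsign, show 2 * r + 1 + 1 = 2 * r + 2 by ring] at h
  have h2 := hdet (r + 1)
  rw [show 2 * (r + 1) = 2 * r + 2 by ring] at h2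
  rw [h2] at h
  refine mul_right_cancel₀ (Finset.prod_ne_zero_iff.mpr
    fun j (_ : j ∈ Finset.range (2 * r + 2)) => risingBinom_ne_zero m j) ?_
  rw [h]
  ring

/-- The rising factorial `x (x + 1) ⋯ (x + k - 1)` of a real number. -/
noncomputable def risingProd (x : ℝ) (k : ℕ) : ℝ := ∏ i ∈ Finset.range k, (x + i)

lemma risingProd_succ (x : ℝ) (k : ℕ) : risingProd x (k + 1) = risingProd x k * (x + k) :=
  Finset.prod_range_succ _ _

lemma prod_range_two_mul (f : ℕ → ℝ) (k : ℕ) : ∏ j ∈ Finset.range (2 * k), f j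
    = (∏ j ∈ Finset.range k, f (2 * j)) * ∏ j ∈ Finset.range k, f (2 * j + 1) := by
  induction k with
  | zero => simp
  | succ k ih =>
    rw [show 2 * (k + 1) = 2 * k + 1 + 1 by ring, Finset.prod_range_succ, Finset.prod_range_succ,
      ih, Finset.prod_range_succ, Finset.prod_range_succ]
    ring

lemma two_pow_mul_prod (f : ℕ → ℝ) (k : ℕ) :
    2 ^ k * ∏ j ∈ Finset.range k, f j = ∏ j ∈ Finset.range k, 2 * f j := by
  rw [Finset.prod_mul_distrib, Finset.prod_const, Finset.card_range]

/-- Separating the factors of `x (x + 1) ⋯ (x + R)` by parity. -/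
lemma prod_split_parity (x : ℝ) (R : ℕ) :
    (∏ j ∈ Finset.range (R / 2 + 1), (x + R - 2 * j))
      * ∏ j ∈ Finset.range (R - R / 2), (x - R + 2 * ((R / 2 : ℕ) + j) + 1)
      = ∏ j ∈ Finset.range (R + 1), (x + j) := by
  have hrefl : ∏ j ∈ Finset.range (R / 2 + 1), (x + R - 2 * j)
      = ∏ j ∈ Finset.range (R / 2 + 1), (x + R - 2 * (R / 2 : ℕ) + 2 * j) := by
    rw [← Finset.prod_range_reflect]
    refine Finset.prod_congr rfl fun j hj => ?_
    rw [Nat.add_sub_cancel, Nat.cast_sub (by simpa [Nat.lt_succ_iff] using hj)]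
    ring
  rw [hrefl]
  rcases Nat.even_or_odd' R with ⟨h, rfl | rfl⟩
  · rw [show 2 * h / 2 = h by omega, show 2 * h - h = h by omega, Finset.prod_range_succ _ (2 * h),
      prod_range_two_mul, Finset.prod_range_succ]
    push_cast
    have e1 : ∏ j ∈ Finset.range h, (x + 2 * h - 2 * h + 2 * j)
        = ∏ j ∈ Finset.range h, (x + 2 * j) := Finset.prod_congr rfl fun j _ => by ring
    have e2 : ∏ j ∈ Finset.range h, (x - 2 * h + 2 * (h + j) + 1)
        = ∏ j ∈ Finset.range h, (x + (2 * j + 1)) := Finset.prod_congr rfl fun j _ => by ring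
    rw [e1, e2]
    ring
  · rw [show (2 * h + 1) / 2 = h by omega, show 2 * h + 1 - h = h + 1 by omega,
      show 2 * h + 1 + 1 = 2 * (h + 1) by ring, prod_range_two_mul, mul_comm]
    push_cast
    congr 1 <;> exact Finset.prod_congr rfl fun j _ => by ring

lemma coeffRatio_mul (m R : ℕ) :
    coeffRatio m R * ((2 * R + 1).factorial * ∏ i ∈ Finset.range (R / 2), ((m : ℝ) / 2 + 2 * R - i))
      = 2 ^ R * (m + 2 * R + 1) * R.factorial
        * (∏ i ∈ Finset.range (R / 2), (((m : ℝ) + 1) / 2 + R + 1 + i))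
        * ∏ j ∈ Finset.range R, ((m : ℝ) / 2 + 2 * R + 2 + j) := by
  have hfac : (R.factorial : ℝ) * ∏ j ∈ Finset.range (R + 1), ((R : ℝ) + j + 1)
      = (2 * R + 1).factorial := by
    rw [show 2 * R + 1 = R + (R + 1) by ring, ← Nat.factorial_mul_ascFactorial,
      Nat.ascFactorial_eq_prod_range]
    push_cast
    congr 1
    exact Finset.prod_congr rfl fun j _ => by ring
  have h1 : ∏ j ∈ Finset.range (R + 1), ((R : ℝ) + j + 1) ≠ 0 :=
    Finset.prod_ne_zero_iff.mpr fun j _ => by positivity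
  have h2 : ∏ j ∈ Finset.range (R + 1), ((m : ℝ) + 3 * R + j + 2) ≠ 0 :=
    Finset.prod_ne_zero_iff.mpr fun j _ => by positivity
  have hsplit := prod_split_parity (m + 3 * R + 2) R
  have e0 : ∏ j ∈ Finset.range (R + 1), ((m : ℝ) + 3 * R + 2 + j)
      = ∏ j ∈ Finset.range (R + 1), ((m : ℝ) + 3 * R + j + 2) :=
    Finset.prod_congr rfl fun j _ => by ring
  have e1 : ∏ j ∈ Finset.range (R / 2 + 1), ((m : ℝ) + 3 * R + 2 + R - 2 * j)
      = 2 ^ (R / 2) * (∏ i ∈ Finset.range (R / 2), ((m : ℝ) / 2 + 2 * R - i))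
        * (m + 4 * R + 2) := by
    rw [Finset.prod_range_succ', two_pow_mul_prod]
    push_cast
    congr 1
    · exact Finset.prod_congr rfl fun j _ => by ring
    · ring
  have e2 : 2 ^ (R / 2) * (∏ i ∈ Finset.range (R / 2), (((m : ℝ) + 1) / 2 + R + 1 + i))
      * ∏ j ∈ Finset.range (R - R / 2), ((m : ℝ) + 3 * R + 2 - R + 2 * ((R / 2 : ℕ) + j) + 1)
      = ∏ j ∈ Finset.range R, ((m : ℝ) + 2 * R + 2 * j + 3) := by
    rw [two_pow_mul_prod]
    have h := Finset.prod_range_add (fun j : ℕ => (m : ℝ) + 2 * R + 2 * j + 3) (R / 2) (R - R / 2)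
    rw [Nat.add_sub_cancel' (Nat.div_le_self R 2)] at h
    rw [h]
    push_cast
    congr 1 <;> exact Finset.prod_congr rfl fun j _ => by ring
  have e3 : ∏ j ∈ Finset.range (R + 1), ((m : ℝ) + 2 * R + 2 * j + 1)
      = (m + 2 * R + 1) * ∏ j ∈ Finset.range R, ((m : ℝ) + 2 * R + 2 * j + 3) := by
    rw [Finset.prod_range_succ', mul_comm]
    push_cast
    congr 1
    · ring
    · exact Finset.prod_congr rfl fun j _ => by ring
  have e4 : ∏ j ∈ Finset.range (R + 1), ((m : ℝ) + 4 * R + 2 * j + 2)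
      = (m + 4 * R + 2) * (2 ^ R * ∏ j ∈ Finset.range R, ((m : ℝ) / 2 + 2 * R + 2 + j)) := by
    rw [Finset.prod_range_succ', mul_comm, two_pow_mul_prod]
    push_cast
    congr 1
    · ring
    · exact Finset.prod_congr rfl fun j _ => by ring
  rw [coeffRatio, Finset.prod_div_distrib, Finset.prod_mul_distrib, Finset.prod_mul_distrib, e3, e4,
    ← hfac, ← e2]
  rw [e0, e1] at hsplit
  rw [← hsplit] at h2 ⊢
  obtain ⟨h3, h4⟩ := mul_ne_zero_iff.mp h2
  obtain ⟨h5, h6⟩ := mul_ne_zero_iff.mp h3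
  obtain ⟨-, h7⟩ := mul_ne_zero_iff.mp h5
  generalize ∏ i ∈ Finset.range (R / 2), ((m : ℝ) / 2 + 2 * R - i) = c at *
  generalize ∏ j ∈ Finset.range (R - R / 2),
    ((m : ℝ) + 3 * R + 2 - R + 2 * ((R / 2 : ℕ) + j) + 1) = d at *
  generalize ∏ j ∈ Finset.range (R + 1), ((R : ℝ) + j + 1) = e at *
  field_simp

lemma prod_risingProd_fst_succ (m R : ℕ) :
    ∏ i ∈ Finset.Icc 1 ((R + 1) / 2), risingProd ((m + 1 + 6 * i) / 2) (R + 1 - 2 * i)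
      = (∏ i ∈ Finset.Icc 1 (R / 2), risingProd ((m + 1 + 6 * i) / 2) (R - 2 * i))
        * ∏ i ∈ Finset.range (R / 2), (((m : ℝ) + 1) / 2 + R + 1 + i) := by
  have hext : ∏ i ∈ Finset.Icc 1 ((R + 1) / 2), risingProd ((m + 1 + 6 * i) / 2) (R + 1 - 2 * i)
      = ∏ i ∈ Finset.Icc 1 (R / 2), risingProd ((m + 1 + 6 * i) / 2) (R + 1 - 2 * i) := by
    refine (Finset.prod_subset (Finset.Icc_subset_Icc_right (by omega)) fun i hi hi' => ?_).symm
    simp only [Finset.mem_Icc] at hi hi'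
    rw [show R + 1 - 2 * i = 0 by omega]
    simp [risingProd]
  rw [hext, ← Finset.Ico_add_one_right_eq_Icc, Finset.prod_Ico_eq_prod_range,
    Finset.prod_Ico_eq_prod_range, Nat.add_sub_cancel, ← Finset.prod_mul_distrib]
  refine Finset.prod_congr rfl fun i hi => ?_
  have hi : i < R / 2 := by simpa using hi
  rw [show R + 1 - 2 * (1 + i) = R - 2 * (1 + i) + 1 by omega, risingProd_succ,
    Nat.cast_sub (by omega)]
  push_cast
  ring

lemma prod_risingProd_snd_succ (m R : ℕ) :
    (∏ i ∈ Finset.Icc 1 ((R + 1) / 2),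
        risingProd ((-m - 6 * (R + 1) + 6 * i - 2) / 2) (R + 2 - 2 * i)) ^ 2
        * (∏ i ∈ Finset.range (R / 2), ((m : ℝ) / 2 + 2 * R - i)) ^ 2
      = (∏ i ∈ Finset.Icc 1 (R / 2), risingProd ((-m - 6 * R + 6 * i - 2) / 2) (R + 1 - 2 * i)) ^ 2
        * (∏ j ∈ Finset.range R, ((m : ℝ) / 2 + 2 * R + 2 + j)) ^ 2 := by
  have hext : ∏ i ∈ Finset.Icc 1 ((R + 1) / 2),
        risingProd ((-m - 6 * (R + 1) + 6 * i - 2) / 2) (R + 2 - 2 * i)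
      = ∏ i ∈ Finset.Icc 1 (R / 2 + 1),
        risingProd ((-m - 6 * (R + 1) + 6 * i - 2) / 2) (R + 2 - 2 * i) := by
    refine Finset.prod_subset (Finset.Icc_subset_Icc_right (by omega)) fun i hi hi' => ?_
    simp only [Finset.mem_Icc] at hi hi'
    rw [show R + 2 - 2 * i = 0 by omega]
    simp [risingProd]
  have hfirst : risingProd (-(m : ℝ) / 2 - 3 * R - 1) R
      = (-1) ^ R * ∏ j ∈ Finset.range R, ((m : ℝ) / 2 + 2 * R + 2 + j) := by
    rw [← Finset.prod_range_reflect]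
    nth_rw 3 [← Finset.card_range R]
    rw [← Finset.prod_const, ← Finset.prod_mul_distrib, risingProd]
    refine Finset.prod_congr rfl fun j hj => ?_
    have : j + 1 ≤ R := by simpa using hj
    rw [Nat.sub_sub, Nat.cast_sub (by omega)]
    push_cast
    ring
  have hden : ∏ i ∈ Finset.range (R / 2), (-(m : ℝ) / 2 - 2 * R + i)
      = (-1) ^ (R / 2) * ∏ i ∈ Finset.range (R / 2), ((m : ℝ) / 2 + 2 * R - i) := by
    nth_rw 2 [← Finset.card_range (R / 2)]
    rw [← Finset.prod_const, ← Finset.prod_mul_distrib]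
    exact Finset.prod_congr rfl fun j _ => by ring
  have hs (k : ℕ) : ((-1 : ℝ) ^ k) ^ 2 = 1 := by rw [← pow_mul, mul_comm, pow_mul]; simp
  have key : (∏ i ∈ Finset.Icc 1 ((R + 1) / 2),
        risingProd ((-m - 6 * (R + 1) + 6 * i - 2) / 2) (R + 2 - 2 * i))
        * (∏ i ∈ Finset.range (R / 2), (-(m : ℝ) / 2 - 2 * R + i))
      = (∏ i ∈ Finset.Icc 1 (R / 2), risingProd ((-m - 6 * R + 6 * i - 2) / 2) (R + 1 - 2 * i))
        * risingProd (-(m : ℝ) / 2 - 3 * R - 1) R := by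
    rw [hext, ← Finset.Ico_add_one_right_eq_Icc, ← Finset.Ico_add_one_right_eq_Icc,
      Finset.prod_Ico_eq_prod_range, Finset.prod_Ico_eq_prod_range, Nat.add_sub_cancel,
      Nat.add_sub_cancel, Finset.prod_range_succ', mul_right_comm, ← Finset.prod_mul_distrib]
    congr 1
    · refine Finset.prod_congr rfl fun i hi => ?_
      have hi : i < R / 2 := by simpa using hi
      rw [show R + 1 - 2 * (1 + i) = R + 2 - 2 * (1 + (i + 1)) + 1 by omega, risingProd_succ,
        Nat.cast_sub (by omega)]
      push_cast
      congr 1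
      · congr 1
        ring
      · ring
    · rw [show R + 2 - 2 * (1 + 0) = R by omega]
      push_cast
      congr 1
      ring
  rw [hfirst, hden] at key
  have := congrArg (· ^ 2) key
  simp only [mul_pow, hs, one_mul] at this
  exact this

lemma xin_product_eq (m R : ℕ) :
    2 ^ (R * (R + 1)) * risingProd ((m + 1) / 2) R
      * (∏ i ∈ Finset.range R, ((i.factorial : ℝ) * (i + 1).factorial
          / ((2 * i).factorial * (2 * i + 2).factorial)))
      * ((∏ i ∈ Finset.Icc 1 (R / 2), risingProd ((m + 1 + 6 * i) / 2) (R - 2 * i)) ^ 2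
        * (∏ i ∈ Finset.Icc 1 (R / 2),
            risingProd ((-m - 6 * R + 6 * i - 2) / 2) (R + 1 - 2 * i)) ^ 2)
      = ∏ s ∈ Finset.range R, coeffRatio m s ^ 2 * (2 * s + 1) / (m + 2 * s + 1) := by
  induction R with
  | zero => simp [risingProd]
  | succ R ih =>
    have h2 := prod_risingProd_snd_succ m R
    have h3 := coeffRatio_mul m R
    have hc : ∏ i ∈ Finset.range (R / 2), ((m : ℝ) / 2 + 2 * R - i) ≠ 0 := by
      refine Finset.prod_ne_zero_iff.mpr fun i hi => ?_
      have : (i : ℝ) < R := by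
        have : i < R / 2 := by simpa using hi
        exact_mod_cast (by omega : i < R)
      have : (0 : ℝ) ≤ m := Nat.cast_nonneg m
      have : (0 : ℝ) ≤ i := Nat.cast_nonneg i
      apply ne_of_gt
      linarith
    rw [prod_risingProd_fst_succ, Finset.prod_range_succ, Finset.prod_range_succ _ R,
      risingProd_succ, ← ih]
    push_cast
    have h2' := eq_div_of_mul_eq (pow_ne_zero 2 hc) h2
    have hf : ((2 * R + 1).factorial : ℝ) ≠ 0 := by positivity
    have h3' := eq_div_of_mul_eq (mul_ne_zero hf hc) h3
    rw [show R + 1 + 1 = R + 2 by ring, h2', h3']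
    simp only [show 2 * R + 2 = 2 * R + 1 + 1 by ring, Nat.factorial_succ]
    have : (m + 2 * R + 1 : ℝ) ≠ 0 := by positivity
    rw [show (R + 1) * (R + 2) = R * (R + 1) + 2 * R + 2 by ring, pow_add, pow_add, pow_mul']
    push_cast
    have hne : (2 * R + 1 + 1 : ℝ) ≠ 0 := by positivity
    have hne' : (2 * R + 1 : ℝ) ≠ 0 := by positivity
    field_simp
    ring

lemma gbinom_natCast (N k : ℕ) : gbinom N k = N.choose k := by
  rw [gbinom, ← descPochhammer_eval_eq_prod_range, descPochhammer_eval_eq_descFactorial,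
    Nat.descFactorial_eq_factorial_mul_choose]
  push_cast
  rw [mul_div_cancel_left₀ _ (by exact_mod_cast k.factorial_ne_zero)]

lemma ofReal_risingProd (x : ℝ) (k : ℕ) : (risingProd x k : ℂ) = poch x k := by
  simp [risingProd, poch]

/-- The determinant formula at `μ = m + 2` with `m` a natural number. -/
lemma xin_determinant_natCast (m r : ℕ) :
    Matrix.det (Matrix.of fun i j : Fin (2 * r + 1) =>
      (if i = j then (-1 : ℂ) else 0)
        + gbinom (((m : ℂ) + 2) + ((i.1 : ℂ) + 1) + ((j.1 : ℂ) + 1) - 2) (j.1 + 1))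
    = (-1) ^ r * (2 ^ ((r + 1) * (r + 2)) * poch ((m + 1) / 2) (r + 1)
      * (∏ i ∈ Finset.range (r + 1), ((i.factorial : ℂ) * (i + 1).factorial
          / ((2 * i).factorial * (2 * i + 2).factorial)))
      * ((∏ i ∈ Finset.Icc 1 ((r + 1) / 2), poch ((m + 1 + 6 * i) / 2) (r + 1 - 2 * i)) ^ 2
        * (∏ i ∈ Finset.Icc 1 ((r + 1) / 2),
            poch ((-m - 6 * (r + 1) + 6 * i - 2) / 2) (r + 2 - 2 * i)) ^ 2)) := by
  have h := det_xin_eq_prod m r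
  rw [← xin_product_eq] at h
  have h := congrArg Complex.ofRealHom h
  rw [RingHom.map_det] at h
  convert h using 1
  · congr 1
    ext i j
    have : ((m : ℂ) + 2) + ((i.1 : ℂ) + 1) + ((j.1 : ℂ) + 1) - 2
        = ((m + (i + 1) + (j + 1) : ℕ) : ℂ) := by push_cast; ring
    rw [Matrix.of_apply, this, gbinom_natCast]
    simp [apply_ite]
  · simp only [map_mul, map_prod, map_pow, Complex.ofRealHom_eq_coe, ofReal_risingProd]
    push_cast
    rfl

open Polynomial in
/-- A polynomial identity in `μ` may be checked at the integers `m + 2`. -/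
lemma eval_eq_of_eval_natCast_add_two {P Q : ℂ[X]}
    (h : ∀ m : ℕ, P.eval ((m : ℂ) + 2) = Q.eval ((m : ℂ) + 2)) (μ : ℂ) : P.eval μ = Q.eval μ := by
  have : P = Q := by
    refine Polynomial.eq_of_infinite_eval_eq P Q ((Set.infinite_range_of_injective
      (f := fun m : ℕ => (m : ℂ) + 2) fun a b hab => by simpa using hab).mono ?_)
    rintro _ ⟨m, rfl⟩
    exact h m
  rw [this]

open Polynomial in
lemma exists_eval_eq_gbinom (a : ℂ) (k : ℕ) : ∃ P : ℂ[X], ∀ μ, P.eval μ = gbinom (μ + a) k :=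
  ⟨C (k.factorial : ℂ)⁻¹ * ∏ i ∈ Finset.range k, (X + C a - C (i : ℂ)), fun μ => by
    simp [gbinom, eval_prod, div_eq_inv_mul]⟩

open Polynomial in
lemma exists_eval_eq_poch (a b : ℂ) (k : ℕ) : ∃ P : ℂ[X], ∀ μ, P.eval μ = poch (a * μ + b) k :=
  ⟨∏ i ∈ Finset.range k, (C a * X + C b + C (i : ℂ)), fun μ => by simp [poch, eval_prod]⟩

/-- Xin's determinant for odd dimension (Theorem 2, odd case). -/
theorem xin_determinant_odd (μ : ℂ) (n : ℕ) (hn : 0 < n) (hno : Odd n) :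
    Matrix.det (Matrix.of fun i j : Fin n =>
      (if i = j then (-1 : ℂ) else 0)
        + gbinom (μ + ((i.1 : ℂ) + 1) + ((j.1 : ℂ) + 1) - 2) (j.1 + 1))
    = (-1) ^ ((n - 1) / 2) * 2 ^ ((n + 3) * (n + 1) / 4) * poch ((μ - 1) / 2) ((n + 1) / 2)
        * (∏ i ∈ Finset.range ((n - 1) / 2 + 1),
            ((i.factorial : ℂ) * ((i + 1).factorial : ℂ)
              / (((2 * i).factorial : ℂ) * ((2 * i + 2).factorial : ℂ))))
        * ∏ i ∈ Finset.Icc 1 ((n + 1) / 4),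
            (poch ((μ + 6 * i - 1) / 2) ((n + 1 - 4 * i) / 2)) ^ 2
              * (poch ((-μ - 3 * n + 6 * i - 3) / 2) ((n + 3 - 4 * i) / 2)) ^ 2 := by
  choose G hG using exists_eval_eq_gbinom
  choose F hF using exists_eval_eq_poch
  obtain ⟨r, rfl⟩ := hno
  have key := eval_eq_of_eval_natCast_add_two
    (P := Matrix.det (Matrix.of fun i j : Fin (2 * r + 1) =>
      (if i = j then (-1 : Polynomial ℂ) else 0)
      + G ((i.1 + 1) + (j.1 + 1) - 2) (j.1 + 1)))
    (Q := Polynomial.C ((-1) ^ r) * (2 ^ ((r + 1) * (r + 2)) * F (1 / 2) (-1 / 2) (r + 1)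
      * Polynomial.C (∏ i ∈ Finset.range (r + 1), ((i.factorial : ℂ) * (i + 1).factorial
          / ((2 * i).factorial * (2 * i + 2).factorial)))
      * ((∏ i ∈ Finset.Icc 1 ((r + 1) / 2), F (1 / 2) ((6 * i - 1) / 2) (r + 1 - 2 * i)) ^ 2
        * (∏ i ∈ Finset.Icc 1 ((r + 1) / 2),
            F (-1 / 2) ((-6 * (r + 1) + 6 * i) / 2) (r + 2 - 2 * i)) ^ 2)))
  have hP (x : ℂ) : (Matrix.det (Matrix.of fun i j : Fin (2 * r + 1) =>
      (if i = j then (-1 : Polynomial ℂ) else 0)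
        + G ((i.1 + 1) + (j.1 + 1) - 2) (j.1 + 1))).eval x
      = Matrix.det (Matrix.of fun i j : Fin (2 * r + 1) => (if i = j then (-1 : ℂ) else 0)
        + gbinom (x + ((i.1 : ℂ) + 1) + ((j.1 : ℂ) + 1) - 2) (j.1 + 1)) := by
    rw [← Polynomial.coe_evalRingHom, RingHom.map_det]
    congr 1
    ext i j
    rw [RingHom.mapMatrix_apply, Matrix.map_apply, Matrix.of_apply, Matrix.of_apply,
      Polynomial.coe_evalRingHom, Polynomial.eval_add, hG]
    congr 1
    · split_ifs <;> simp
    · congr 1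
      ring
  simp only [hP, Polynomial.eval_mul, Polynomial.eval_C, Polynomial.eval_pow,
    Polynomial.eval_prod, hF, Polynomial.eval_ofNat] at key
  rw [key fun m => ?_, show (2 * r + 1 - 1) / 2 = r by omega,
    show (2 * r + 1 + 1) / 2 = r + 1 by omega, show (2 * r + 1 + 1) / 4 = (r + 1) / 2 by omega,
    show (2 * r + 1 + 3) * (2 * r + 1 + 1) / 4 = (r + 1) * (r + 2) by
      rw [show (2 * r + 1 + 3) * (2 * r + 1 + 1) = (r + 1) * (r + 2) * 4 by ring]
      exact Nat.mul_div_cancel _ (by norm_num),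
    Finset.prod_mul_distrib, Finset.prod_pow, Finset.prod_pow]
  · have e1 (i : ℕ) : (2 * r + 1 + 1 - 4 * i) / 2 = r + 1 - 2 * i := by omega
    have e2 (i : ℕ) : (2 * r + 1 + 3 - 4 * i) / 2 = r + 2 - 2 * i := by omega
    have e3 (i : ℕ) : 1 / 2 * μ + (6 * i - 1) / 2 = (μ + 6 * i - 1) / 2 := by ring
    have e4 (i : ℕ) : -1 / 2 * μ + (-6 * (r + 1) + 6 * i) / 2
        = (-μ - 3 * (2 * r + 1 : ℕ) + 6 * i - 3) / 2 := by push_cast; ring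
    have e5 : 1 / 2 * μ + -1 / 2 = (μ - 1) / 2 := by ring
    simp only [e1, e2, e3, e4, e5]
    ring
  · rw [xin_determinant_natCast]
    have e3 (i : ℕ) : 1 / 2 * ((m : ℂ) + 2) + (6 * i - 1) / 2 = (m + 1 + 6 * i) / 2 := by ring
    have e4 (i : ℕ) : -1 / 2 * ((m : ℂ) + 2) + (-6 * (r + 1) + 6 * i) / 2
        = (-m - 6 * (r + 1) + 6 * i - 2) / 2 := by ring
    have e5 : 1 / 2 * ((m : ℂ) + 2) + -1 / 2 = (m + 1) / 2 := by ring
    simp only [e3, e4, e5]
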